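/- From the position P1, placing a chap at c4 is Betty's unique non-losing move: after Betty places a chap at c4, Alfred has no winning strategy from the resulting position, while after every other legal move of Betty from P1, Alfred has a winning strategy from the resulting position. -/

import Mathlib

/-!
Formalization of Philosophers' Phutball on an `m × n` board (`m` rows, `n` columns).
Points are pairs `(column, row)` of integers, with columns `1, …, n` (a, b, c, …)
and rows `1, …, m` (bottom to top).  Player `true` is Alfred (first player, aims
for the top row `m`); player `false` is Betty (aims for the bottom row `1`).
-/

/-- A player: `true` is Alfred, `false` is Betty. -/
abbrev Player := Bool

/-- A Phutball position: the ball's point `(column, row)`, the finite set of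
chaps, and the player whose turn it is. -/
structure PState where
  ball : ℤ × ℤ
  chaps : Finset (ℤ × ℤ)
  turn : Player
deriving DecidableEq

/-- The eight horizontal, vertical and diagonal directions. -/
def dirs : Finset (ℤ × ℤ) :=
  {(1, 0), (1, 1), (0, 1), (-1, 1), (-1, 0), (-1, -1), (0, -1), (1, -1)}

/-- The point reached from `b` after `i` steps in direction `d`. -/
def ray (b d : ℤ × ℤ) (i : ℤ) : ℤ × ℤ := (b.1 + i * d.1, b.2 + i * d.2)

/-- A point is on the `m × n` board. -/
def OnBoard (m n : ℤ) (p : ℤ × ℤ) : Prop :=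
  1 ≤ p.1 ∧ p.1 ≤ n ∧ 1 ≤ p.2 ∧ p.2 ≤ m

/-- A single hop on a board with `n` columns: the ball at `b` moves in one of the
eight directions `d` over a contiguous nonempty line of `k` chaps, landing on the
first point beyond them that carries no chap; the jumped-over chaps are removed.
The landing point must not lie onto or past the sidelines (outside columns
`1, …, n`), but it may lie past the top or bottom row. -/
def Hop (n : ℤ) (b : ℤ × ℤ) (c : Finset (ℤ × ℤ)) (b' : ℤ × ℤ) (c' : Finset (ℤ × ℤ)) : Prop :=
  ∃ d ∈ dirs, ∃ k : ℕ, 1 ≤ k ∧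
    (∀ i : ℕ, 1 ≤ i → i ≤ k → ray b d i ∈ c) ∧
    ray b d (k + 1) ∉ c ∧
    1 ≤ (ray b d (k + 1)).1 ∧ (ray b d (k + 1)).1 ≤ n ∧
    b' = ray b d (k + 1) ∧
    c' = c \ Finset.image (fun i : ℕ => ray b d i) (Finset.Icc 1 k)

/-- A jump is a nonempty sequence of hops (the player may stop after any hop,
and the removed chaps cannot be re-used by later hops of the same jump).  The
jump can continue after a hop only if the ball has not been carried past the top
or bottom row (which would end the game immediately). -/
inductive Jump (m n : ℤ) : ℤ × ℤ → Finset (ℤ × ℤ) → ℤ × ℤ → Finset (ℤ × ℤ) → Prop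
  | single {b c b' c'} : Hop n b c b' c' → Jump m n b c b' c'
  | cons {b c b₁ c₁ b' c'} : Hop n b c b₁ c₁ → 1 ≤ b₁.2 → b₁.2 ≤ m →
      Jump m n b₁ c₁ b' c' → Jump m n b c b' c'

/-- The winner, if any, of a position (evaluated between turns): Alfred wins if
the ball rests on the top row `m` or has been carried past it; Betty wins if the
ball rests on the bottom row `1` or has been carried past it. -/
def winner (m : ℤ) (s : PState) : Option Player :=
  if m ≤ s.ball.2 then some true else if s.ball.2 ≤ 1 then some false else none

/-- A single legal move on the `m × n` board: the player to move either places a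
chap on a vacant on-board point, or moves the ball by a jump; the turn passes to
the other player. -/
def MoveRel (m n : ℤ) (s t : PState) : Prop :=
  t.turn = !s.turn ∧
    ((∃ p, OnBoard m n p ∧ p ∉ s.chaps ∧ p ≠ s.ball ∧
        t.ball = s.ball ∧ t.chaps = insert p s.chaps) ∨
      Jump m n s.ball s.chaps t.ball t.chaps)

/-- An infinite record of play: while the game is not over and a legal move
exists, a legal move is made; otherwise the position is frozen forever. -/
def IsPlay (m n : ℤ) (f : ℕ → PState) : Prop :=
  ∀ k,
    (winner m (f k) = none ∧ (∃ t, MoveRel m n (f k) t) ∧ MoveRel m n (f k) (f (k + 1))) ∨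
    ((winner m (f k) ≠ none ∨ ¬ ∃ t, MoveRel m n (f k) t) ∧ f (k + 1) = f k)

/-- A strategy for player `p` that always proposes a legal move whenever the game
is not over, it is `p`'s turn, and some legal move exists. -/
def LegalStrategy (m n : ℤ) (p : Player) (σ : PState → PState) : Prop :=
  ∀ s, s.turn = p → winner m s = none → (∃ t, MoveRel m n s t) → MoveRel m n s (σ s)

/-- The play `f` follows the strategy `σ` of player `p`. -/
def Follows (m n : ℤ) (p : Player) (σ : PState → PState) (f : ℕ → PState) : Prop :=
  ∀ k, (f k).turn = p → winner m (f k) = none → (∃ t, MoveRel m n (f k) t) →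
    f (k + 1) = σ (f k)

/-- Player `p` has a winning strategy from `s₀` on the `m × n` board: a legal
strategy guaranteeing that, against every play of the opponent, `p` wins after
finitely many moves. -/
def WinsFrom (m n : ℤ) (p : Player) (s₀ : PState) : Prop :=
  ∃ σ, LegalStrategy m n p σ ∧
    ∀ f, IsPlay m n f → f 0 = s₀ → Follows m n p σ f → ∃ k, winner m (f k) = some p

/-- Player `p` has a drawing strategy from `s₀` on the `m × n` board: a legal
strategy guaranteeing that the opponent never wins (play may continue forever). -/
def DrawsFrom (m n : ℤ) (p : Player) (s₀ : PState) : Prop :=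
  ∃ σ, LegalStrategy m n p σ ∧
    ∀ f, IsPlay m n f → f 0 = s₀ → Follows m n p σ f → ∀ k, winner m (f k) ≠ some (!p)

/-- A position is drawn if both players have drawing strategies from it. -/
def Drawn (m n : ℤ) (s : PState) : Prop :=
  DrawsFrom m n true s ∧ DrawsFrom m n false s

/-- The 24 chaps of the position `P0` on the 12 × 10 board:
c1, c2, c5, c7, c9, c10, c11, c12, d6, e4, e11, e12, f1, f2, f9, g7,
h1, h2, h3, h4, h6, h8, h11, h12. -/
def P0chaps : Finset (ℤ × ℤ) :=
  {(3, 1), (3, 2), (3, 5), (3, 7), (3, 9), (3, 10), (3, 11), (3, 12), (4, 6), (5, 4), (5, 11), (5, 12), (6, 1), (6, 2), (6, 9), (7, 7), (8, 1), (8, 2), (8, 3), (8, 4), (8, 6), (8, 8), (8, 11), (8, 12)}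

/-- The position `P0`: ball at a2 = (1, 2), the 24 chaps above, Alfred to move. -/
def P0 : PState := ⟨(1, 2), P0chaps, true⟩

/-- The position `P1`: `P0` with additional chaps at b3, with Betty to move. -/
def P1 : PState := ⟨(1, 2), P0chaps ∪ {(2, 3)}, false⟩

/-- The result of Betty placing a chap at c4 = (3, 4) from `P1`. -/
def P1_c4 : PState := ⟨(1, 2), insert (3, 4) P1.chaps, true⟩

/-! ### A decision procedure on bitmask configurations -/

/-- A ball together with a set of chaps on the `12 × 10` board, coded as a bitmask. -/
abbrev Conf := (ℤ × ℤ) × ℕ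

/-- The bit that codes the point `p`. -/
def bitIndex (p : ℤ × ℤ) : ℕ := (16 * p.1 + p.2).toNat

/-- The point `p` is on the `12 × 10` board. -/
def inBoard (p : ℤ × ℤ) : Bool := decide (1 ≤ p.1 ∧ p.1 ≤ 10 ∧ 1 ≤ p.2 ∧ p.2 ≤ 12)

/-- The bitmask `N` has a chap at `p`. -/
def hasChap (N : ℕ) (p : ℤ × ℤ) : Bool := inBoard p && N.testBit (bitIndex p)

/-- The set of chaps coded by the bitmask `N`. -/
noncomputable def chapSet (N : ℕ) : Finset (ℤ × ℤ) :=
  ((Finset.Icc 1 10) ×ˢ (Finset.Icc 1 12)).filter fun p => hasChap N p = true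

/-- Add a chap at `p`. -/
def addChap (N : ℕ) (p : ℤ × ℤ) : ℕ := N ||| 2 ^ bitIndex p

/-- Remove the chap at `p`, if there is one. -/
def delChap (N : ℕ) (p : ℤ × ℤ) : ℕ := (N ||| 2 ^ bitIndex p) ^^^ 2 ^ bitIndex p

/-- The bitmask of a list of points. -/
def maskOf (l : List (ℤ × ℤ)) : ℕ := l.foldl addChap 0

/-- The eight directions in a fixed order. -/
def dirList : List (ℤ × ℤ) :=
  [(1, 0), (1, 1), (0, 1), (-1, 1), (-1, 0), (-1, -1), (0, -1), (1, -1)]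

/-- Follow the line of chaps of `N` from `p` in direction `d`, deleting them from `M`,
up to the landing point. -/
def slide (d : ℤ × ℤ) (N : ℕ) : ℕ → ℤ × ℤ → ℕ → Option Conf
  | 0, _, _ => none
  | k + 1, p, M =>
    if hasChap N p then slide d N k (p + d) (delChap M p)
    else if 1 ≤ p.1 ∧ p.1 ≤ 10 then some (p, M) else none

/-- The hop in direction `d`, if there is one. -/
def hop (d : ℤ × ℤ) (c : Conf) : Option Conf :=
  if hasChap c.2 (c.1 + d) then slide d c.2 13 (c.1 + d) c.2 else none

/-- A jump may continue from `b`. -/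
def inRows (b : ℤ × ℤ) : Bool := decide (1 ≤ b.2 ∧ b.2 ≤ 12)

/-- All results of jumps of at most the given number of hops. -/
def jumps : ℕ → Conf → List Conf
  | 0, _ => []
  | k + 1, c => dirList.flatMap fun d =>
    match hop d c with
    | none => []
    | some r => r :: if inRows r.1 then jumps k r else []

/-- The points where an extra chap could change the set of available jumps. -/
def jumpZone : ℕ → Conf → List (ℤ × ℤ)
  | 0, _ => []
  | k + 1, c => dirList.flatMap fun d => (c.1 + d) ::
    match hop d c with
    | none => []
    | some r => r.1 :: if inRows r.1 then jumpZone k r else []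

/-- The winner when the ball rests at `b`. -/
def outcome (b : ℤ × ℤ) : Option Player := winner 12 ⟨b, ∅, true⟩

/-- The landing points of a jump that wins for `p`, found by depth-first search. -/
def winningJump (p : Player) : ℕ → Conf → Option (List (ℤ × ℤ))
  | 0, _ => none
  | k + 1, c => dirList.findSome? fun d =>
    match hop d c with
    | none => none
    | some r =>
      if outcome r.1 = some p then some [r.1]
      else if inRows r.1 then (winningJump p k r).map (r.1 :: ·) else none

/-- The point `q` is vacant in the configuration `c`. -/
def vacant (q : ℤ × ℤ) (c : Conf) : Bool := inBoard q && !hasChap c.2 q && decide (q ≠ c.1)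

/-- The configurations after placing a chap at one of the points of `Z`. -/
def placements (Z : List (ℤ × ℤ)) (c : Conf) : List Conf :=
  (Z.filter (vacant · c)).map fun q => (c.1, addChap c.2 q)

/-- Run the attack `att` on all configurations of a list, threading the stream of proposed
placements and collecting the relevant points. -/
def attackAll (att : Conf → List (ℤ × ℤ) → Option (List (ℤ × ℤ) × List (ℤ × ℤ))) :
    List Conf → List (ℤ × ℤ) → List (ℤ × ℤ) → Option (List (ℤ × ℤ) × List (ℤ × ℤ))
  | [], Z, cs => some (Z, cs)
  | r :: rs, Z, cs =>
    match att r cs with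
    | none => none
    | some (Z', cs₁) => attackAll att rs (Z' ++ Z) cs₁

/-- Run the attack `att` on `c` as if the opponent passed, and then on all replies of the
opponent that interfere with that attack, except those in `skip`. -/
def refute (att : Conf → List (ℤ × ℤ) → Option (List (ℤ × ℤ) × List (ℤ × ℤ)))
    (skip : List Conf) (c : Conf) (cs : List (ℤ × ℤ)) :
    Option (List (ℤ × ℤ) × List (ℤ × ℤ)) :=
  match att c cs with
  | none => none
  | some (Z, cs₁) =>
    attackAll att ((placements Z c ++ jumps 121 c).filter (· ∉ skip)) (Z ++ jumpZone 121 c) cs₁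

/-- Verify that `p`, to move in `c`, wins by a winning jump or else by the placements proposed
in the stream `cs`.  Returns the points the attack depends on and the rest of the stream. -/
def attack (p : Player) : ℕ → Conf → List (ℤ × ℤ) → Option (List (ℤ × ℤ) × List (ℤ × ℤ))
  | 0, _, _ => none
  | k + 1, c, cs =>
    if outcome c.1 = some p then some ([], cs)
    else if outcome c.1 = none then
      match winningJump p 8 c with
      | some L => some (L, cs)
      | none =>
        match cs with
        | [] => none
        | q :: cs =>
          if vacant q c then
            (refute (attack p k) [] (c.1, addChap c.2 q) cs).map fun x => ((q :: x.1).dedup, x.2)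
          else none
    else none

/-- A move of the main line: a placement, or the first jump ending at a given point. -/
inductive LineMove
  | place (q : ℤ × ℤ)
  | jump (q : ℤ × ℤ)

/-- Carry out a move of the main line. -/
def LineMove.apply : LineMove → Conf → Option Conf
  | place q, c => if vacant q c then some (c.1, addChap c.2 q) else none
  | jump q, c => (jumps 121 c).find? fun r => decide (r.1 = q)

/-- Verify that along a line of moves of Alfred and Betty every deviation by Alfred loses, and
that the line ends in `goal`. -/
def lineCheck (goal : Conf) : List (LineMove × LineMove × List (ℤ × ℤ)) → Conf → Bool
  | [], c => decide (c = goal)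
  | (a, b, cs) :: l, c =>
    match a.apply c with
    | none => false
    | some r => decide (outcome c.1 = none) && decide (outcome r.1 = none) &&
      (refute (attack false 20) [r] c cs).isSome &&
      match b.apply r with
      | none => false
      | some c₁ => lineCheck goal l c₁

/-- The configuration of `P1`. -/
def confP1 : Conf := ((1, 2), maskOf
  [(3, 1), (3, 2), (3, 5), (3, 7), (3, 9), (3, 10), (3, 11), (3, 12), (4, 6), (5, 4), (5, 11),
    (5, 12), (6, 1), (6, 2), (6, 9), (7, 7), (8, 1), (8, 2), (8, 3), (8, 4), (8, 6), (8, 8),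
    (8, 11), (8, 12), (2, 3)])

/-- The configuration of `P1_c4`. -/
def confP1c4 : Conf := ((1, 2), addChap confP1.2 (3, 4))

/-- The main line from `P1_c4` back to itself, with the refutations of Alfred's deviations. -/
def mainLine : List (LineMove × LineMove × List (ℤ × ℤ)) :=
  [(.place (4, 5), .place (5, 6), [(3, 6), (2, 4), (2, 6), (2, 4), (2, 4)]),
   (.place (6, 7), .place (7, 8), [(8, 8)]),
   (.place (8, 9), .place (9, 10), [(7, 7)]),
   (.jump (10, 11), .place (9, 10), [(10, 11), (2, 1), (2, 1), (2, 1), (9, 10), (7, 8), (5, 6),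
      (3, 4), (3, 6), (2, 4), (2, 6), (2, 4), (2, 4), (8, 8), (7, 7), (10, 11), (2, 1), (10, 11),
      (2, 1)]),
   (.place (8, 9), .place (7, 8), [(7, 7)]),
   (.place (6, 7), .place (5, 6), [(8, 8)]),
   (.place (4, 5), .place (3, 4), [(3, 6), (2, 4), (2, 6), (2, 4), (2, 4)]),
   (.place (2, 3), .jump (1, 2), []),
   (.place (2, 3), .place (3, 4), [(2, 1), (2, 1), (1, 3)])]

/-! ### Forced wins and drawing regions -/

/-- Player `p` can force a win from `s` within `k` moves. -/
inductive Forces (m n : ℤ) (p : Player) : ℕ → PState → Prop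
  | won {k s} : winner m s = some p → Forces m n p k s
  | mine {k s t} : winner m s = none → s.turn = p → MoveRel m n s t → Forces m n p k t →
      Forces m n p (k + 1) s
  | theirs {k s} : winner m s = none → s.turn ≠ p → (∃ t, MoveRel m n s t) →
      (∀ t, MoveRel m n s t → Forces m n p k t) → Forces m n p (k + 1) s

section Strategies

variable {m n : ℤ} {p : Player}

theorem Forces.exists_move {k : ℕ} {s : PState} (h : Forces m n p k s)
    (hs : winner m s = none) : ∃ t, MoveRel m n s t := by
  cases h with
  | won h => simp [hs] at h
  | mine _ _ h _ => exact ⟨_, h⟩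
  | theirs _ _ h _ => exact h

theorem IsPlay.moveRel {f : ℕ → PState} (hf : IsPlay m n f) {k : ℕ}
    (hw : winner m (f k) = none) (ht : ∃ t, MoveRel m n (f k) t) :
    MoveRel m n (f k) (f (k + 1)) := by
  rcases hf k with h | h
  · exact h.2.2
  · exact absurd h.1 (by simp [hw, ht])

open Classical in
/-- A forced win yields a winning strategy: always decrease the number of moves needed. -/
theorem Forces.winsFrom {k : ℕ} {s : PState} (h : Forces m n p k s) : WinsFrom m n p s := by
  set rank : PState → ℕ := fun s => sInf {k | Forces m n p k s}
  set good : PState → PState → Prop := fun s t => MoveRel m n s t ∧ Forces m n p (rank s - 1) t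
  set σ : PState → PState := fun s =>
    if h : ∃ t, good s t then h.choose else if h : ∃ t, MoveRel m n s t then h.choose else s
  have hσ : ∀ s, (∃ t, good s t) → good s (σ s) := by
    intro s hs
    simp only [σ, dif_pos hs]
    exact hs.choose_spec
  refine ⟨σ, ?_, ?_⟩
  · intro s _ _ ht
    by_cases hs : ∃ t, good s t
    · exact (hσ s hs).1
    · simp only [σ, dif_neg hs, dif_pos ht]
      exact ht.choose_spec
  · intro f hf h0 hfol
    suffices H : ∀ k i, Forces m n p k (f i) → ∃ j, winner m (f j) = some p from
      H k 0 (h0 ▸ h)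
    intro k
    induction k using Nat.strong_induction_on with
    | _ k ih =>
      intro i hi
      have hle : rank (f i) ≤ k := Nat.sInf_le hi
      have hr : Forces m n p (rank (f i)) (f i) :=
        Nat.sInf_mem (s := {k | Forces m n p k (f i)}) ⟨k, hi⟩
      generalize hl : rank (f i) = l at hle hr
      cases hr with
      | won h => exact ⟨i, h⟩
      | @mine l _ t h₁ h₂ h₃ h₄ =>
        have hg := hσ (f i) ⟨t, h₃, by simpa [hl] using h₄⟩
        rw [← hfol i h₂ h₁ ⟨t, h₃⟩] at hg
        exact ih l hle (i + 1) (by simpa [hl] using hg.2)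
      | @theirs l _ h₁ h₂ h₃ h₄ =>
        exact ih l hle (i + 1) (h₄ _ (hf.moveRel h₁ h₃))

open Classical in
/-- If the opponent of `p` can keep the play in a region containing no win of `p`, then `p` has no
winning strategy. -/
theorem not_winsFrom_of_region (X : PState → Prop)
    (hX : ∀ s, X s → winner m s ≠ some p)
    (hp : ∀ s, X s → winner m s = none → s.turn = p → ∀ t, MoveRel m n s t → X t)
    (ho : ∀ s, X s → winner m s = none → s.turn ≠ p → ∃ t, MoveRel m n s t ∧ X t)
    {s : PState} (hs : X s) : ¬ WinsFrom m n p s := by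
  rintro ⟨σ, hσ, hwin⟩
  set reply : PState → PState := fun s =>
    if h : ∃ t, MoveRel m n s t ∧ X t then h.choose else s
  set next : PState → PState := fun s =>
    if winner m s = none ∧ ∃ t, MoveRel m n s t then (if s.turn = p then σ s else reply s) else s
  set f : ℕ → PState := fun k => next^[k] s
  have hf : ∀ k, f (k + 1) = next (f k) := fun k => Function.iterate_succ_apply' _ _ _
  have hnext : ∀ s, X s → winner m s = none → (∃ t, MoveRel m n s t) →
      MoveRel m n s (next s) ∧ X (next s) := by
    intro s hs hw ht
    by_cases hturn : s.turn = p
    · have : next s = σ s := by simp only [next, if_pos (And.intro hw ht), if_pos hturn]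
      rw [this]
      exact ⟨hσ s hturn hw ht, hp s hs hw hturn _ (hσ s hturn hw ht)⟩
    · have hr := ho s hs hw hturn
      have : next s = hr.choose := by
        simp only [next, if_pos (And.intro hw ht), if_neg hturn, reply, dif_pos hr]
      rw [this]
      exact hr.choose_spec
  have hhalt : ∀ s, ¬ (winner m s = none ∧ ∃ t, MoveRel m n s t) → next s = s := by
    intro s h
    simp only [next, if_neg h]
  have hXf : ∀ k, X (f k) := by
    intro k
    induction k with
    | zero => exact hs
    | succ k ih =>
      rw [hf]
      by_cases h : winner m (f k) = none ∧ ∃ t, MoveRel m n (f k) t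
      · exact (hnext _ ih h.1 h.2).2
      · rwa [hhalt _ h]
  have hplay : IsPlay m n f := by
    intro k
    rw [hf]
    by_cases h : winner m (f k) = none ∧ ∃ t, MoveRel m n (f k) t
    · exact .inl ⟨h.1, h.2, (hnext _ (hXf k) h.1 h.2).1⟩
    · exact .inr ⟨by tauto, hhalt _ h⟩
  obtain ⟨k, hk⟩ := hwin f hplay rfl fun k hturn hw ht => by
    simp only [hf, next, if_pos (And.intro hw ht), if_pos hturn]
  exact hX _ (hXf k) hk

end Strategies

/-! ### Bitmasks -/

theorem inBoard_iff {p : ℤ × ℤ} : inBoard p = true ↔ OnBoard 12 10 p := by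
  simp [inBoard, OnBoard]

theorem mem_chapSet {N : ℕ} {p : ℤ × ℤ} : p ∈ chapSet N ↔ hasChap N p = true := by
  simp only [chapSet, Finset.mem_filter, Finset.mem_product, Finset.mem_Icc, hasChap, inBoard,
    Bool.and_eq_true, decide_eq_true_eq]
  tauto

theorem onBoard_of_mem_chapSet {N : ℕ} {p : ℤ × ℤ} (h : p ∈ chapSet N) : OnBoard 12 10 p := by
  rw [mem_chapSet, hasChap, Bool.and_eq_true] at h
  exact inBoard_iff.1 h.1

theorem bitIndex_eq_iff {p q : ℤ × ℤ} (hp : OnBoard 12 10 p) (hq : OnBoard 12 10 q) :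
    bitIndex q = bitIndex p ↔ p = q := by
  obtain ⟨_, _, _, _⟩ := hp
  obtain ⟨_, _, _, _⟩ := hq
  rw [Prod.ext_iff, bitIndex, bitIndex]
  omega

theorem chapSet_addChap {N : ℕ} {p : ℤ × ℤ} (hp : OnBoard 12 10 p) :
    chapSet (addChap N p) = insert p (chapSet N) := by
  ext q
  simp only [Finset.mem_insert, mem_chapSet, hasChap, addChap, Nat.testBit_or,
    Nat.testBit_two_pow, Bool.and_eq_true, Bool.or_eq_true, decide_eq_true_eq, inBoard_iff]
  constructor
  · rintro ⟨hq, h | h⟩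
    · exact .inr ⟨hq, h⟩
    · exact .inl ((bitIndex_eq_iff hq hp).1 h)
  · rintro (rfl | h)
    · exact ⟨hp, .inr rfl⟩
    · exact ⟨h.1, .inl h.2⟩

theorem chapSet_delChap {N : ℕ} {p : ℤ × ℤ} (hp : OnBoard 12 10 p) :
    chapSet (delChap N p) = (chapSet N).erase p := by
  ext q
  simp only [Finset.mem_erase, mem_chapSet, hasChap, delChap, Nat.testBit_or, Nat.testBit_xor,
    Nat.testBit_two_pow, Bool.and_eq_true, inBoard_iff]
  have key : OnBoard 12 10 q → (bitIndex p = bitIndex q ↔ q = p) := fun hq =>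
    bitIndex_eq_iff hq hp
  by_cases hq : OnBoard 12 10 q
  · simp only [key hq, hq, true_and]
    by_cases h : q = p <;> simp [h]
  · simp [hq]

/-! ### Hops -/

theorem mem_dirList {d : ℤ × ℤ} : d ∈ dirList ↔ d ∈ dirs := by
  simp [dirList, dirs]

theorem ray_one (b d : ℤ × ℤ) : ray b d 1 = b + d := by
  simp [ray, Prod.ext_iff]

theorem ray_add (b d : ℤ × ℤ) (i j : ℤ) : ray (ray b d i) d j = ray b d (i + j) := by
  simp only [ray, Prod.mk.injEq]
  constructor <;> ring

/-- A line of points of the board has at most twelve points. -/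
theorem le_of_onBoard_ray {b d : ℤ × ℤ} {k : ℕ} (hd : d ∈ dirs)
    (h₁ : OnBoard 12 10 (ray b d 1)) (h₂ : OnBoard 12 10 (ray b d k)) : k ≤ 12 := by
  simp only [OnBoard, ray] at h₁ h₂
  simp only [dirs, Finset.mem_insert, Finset.mem_singleton] at hd
  rcases hd with rfl | rfl | rfl | rfl | rfl | rfl | rfl | rfl <;> simp at h₁ h₂ <;> omega

theorem slide_eq_some {d : ℤ × ℤ} {N : ℕ} {b : ℤ × ℤ} {k : ℕ} :
    ∀ {j : ℕ} {i M : ℕ}, (∀ l : ℕ, i ≤ l → l < i + j → ray b d l ∈ chapSet N) →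
      ray b d (i + j : ℕ) ∉ chapSet N →
      1 ≤ (ray b d (i + j : ℕ)).1 → (ray b d (i + j : ℕ)).1 ≤ 10 → j < k →
      ∃ M', slide d N k (ray b d i) M = some (ray b d (i + j : ℕ), M') ∧
        chapSet M' = chapSet M \ (Finset.Ico i (i + j)).image fun l : ℕ => ray b d l := by
  induction k with
  | zero => intro j i M _ _ _ _ h; omega
  | succ k ih =>
    intro j i M hmem hnot h₁ h₂ hj
    cases j with
    | zero =>
      rw [mem_chapSet] at hnot
      simp only [Nat.add_zero] at hnot h₁ h₂ ⊢
      exact ⟨M, by simp [slide, hnot, h₁, h₂], by simp⟩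
    | succ j =>
      have hi := hmem i le_rfl (by omega)
      obtain ⟨M', hM', hM''⟩ := ih (j := j) (i := i + 1) (M := delChap M (ray b d i))
        (fun l h h' => hmem l (by omega) (by omega)) (by convert hnot using 3; omega)
        (by convert h₁ using 4; omega) (by convert h₂ using 4; omega) (by omega)
      have hij : i + 1 + j = i + (j + 1) := by omega
      rw [hij] at hM' hM''
      refine ⟨M', ?_, ?_⟩
      · rw [slide, if_pos (mem_chapSet.1 hi), ← hM']
        congr 1
        rw [← ray_one, ray_add]
        push_cast
        rfl
      · rw [hM'', chapSet_delChap (onBoard_of_mem_chapSet hi),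
          ← Finset.insert_Ico_succ_left_eq_Ico (show i < i + (j + 1) by omega),
          Finset.image_insert, Finset.sdiff_insert, Finset.erase_sdiff_comm]
        rfl

theorem exists_of_slide_eq_some {d : ℤ × ℤ} {N : ℕ} {b : ℤ × ℤ} {r : Conf} {k : ℕ} :
    ∀ {i M : ℕ}, slide d N k (ray b d i) M = some r →
      ∃ j : ℕ, (∀ l : ℕ, i ≤ l → l < i + j → ray b d l ∈ chapSet N) ∧
        ray b d (i + j : ℕ) ∉ chapSet N ∧
        1 ≤ (ray b d (i + j : ℕ)).1 ∧ (ray b d (i + j : ℕ)).1 ≤ 10 ∧ r.1 = ray b d (i + j : ℕ) ∧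
        chapSet r.2 = chapSet M \ (Finset.Ico i (i + j)).image fun l : ℕ => ray b d l := by
  induction k with
  | zero => intro i M h; simp [slide] at h
  | succ k ih =>
    intro i M h
    rw [slide] at h
    split_ifs at h with h₁ h₂
    · have hi := mem_chapSet.2 h₁
      have hstep : ray b d i + d = ray b d (i + 1 : ℕ) := by
        rw [← ray_one, ray_add]
        push_cast
        rfl
      rw [hstep] at h
      obtain ⟨j, h₂, h₃, h₄, h₅, h₆, h₇⟩ := ih h
      have hij : i + 1 + j = i + (j + 1) := by omega
      rw [hij] at h₃ h₄ h₅ h₆ h₇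
      refine ⟨j + 1, fun l hl hl' => ?_, h₃, h₄, h₅, h₆, ?_⟩
      · rcases hl.eq_or_lt with rfl | hl
        · exact hi
        · exact h₂ l hl (by omega)
      · rw [h₇, chapSet_delChap (onBoard_of_mem_chapSet hi),
          ← Finset.insert_Ico_succ_left_eq_Ico (show i < i + (j + 1) by omega),
          Finset.image_insert, Finset.sdiff_insert, Finset.erase_sdiff_comm]
        rfl
    · cases h
      exact ⟨0, by intros; omega, by simpa [mem_chapSet] using h₁, by simpa using h₂.1,
        by simpa using h₂.2, by simp, by simp⟩

theorem hop_eq_some {d b : ℤ × ℤ} {N k : ℕ} (hd : d ∈ dirs) (hk : 1 ≤ k)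
    (hmem : ∀ i : ℕ, 1 ≤ i → i ≤ k → ray b d i ∈ chapSet N) (hnot : ray b d (k + 1) ∉ chapSet N)
    (h₁ : 1 ≤ (ray b d (k + 1)).1) (h₂ : (ray b d (k + 1)).1 ≤ 10) :
    ∃ N', hop d (b, N) = some (ray b d (k + 1), N') ∧
      chapSet N' = chapSet N \ (Finset.Icc 1 k).image fun i : ℕ => ray b d i := by
  have h1 : ray b d (1 : ℕ) ∈ chapSet N := hmem 1 le_rfl hk
  have hk12 : k ≤ 12 := le_of_onBoard_ray hd (onBoard_of_mem_chapSet (by simpa using h1))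
    (onBoard_of_mem_chapSet (hmem k hk le_rfl))
  have hcast : ((1 + k : ℕ) : ℤ) = k + 1 := by push_cast; ring
  obtain ⟨N', h, h'⟩ := slide_eq_some (d := d) (b := b) (N := N) (k := 13) (j := k) (i := 1)
    (M := N) (fun l h h' => hmem l h (by omega)) (by rwa [hcast]) (by rwa [hcast])
    (by rwa [hcast]) (by omega)
  refine ⟨N', ?_, ?_⟩
  · rw [hcast, Nat.cast_one, ray_one] at h
    rw [Nat.cast_one, ray_one, mem_chapSet] at h1
    simp only [hop, if_pos h1, h]
  · rw [h', add_comm 1 k]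
    rfl

/-- A hop survives adding chaps away from its landing point. -/
theorem hop_sound {d : ℤ × ℤ} {c r : Conf} {A : Finset (ℤ × ℤ)} (hd : d ∈ dirs)
    (h : hop d c = some r) (hA : Disjoint (chapSet c.2) A) (hr : r.1 ∉ A) :
    Hop 10 c.1 (chapSet c.2 ∪ A) r.1 (chapSet r.2 ∪ A) := by
  obtain ⟨b, N⟩ := c
  simp only [hop] at h
  split_ifs at h with h1
  rw [← ray_one, ← Nat.cast_one] at h h1
  obtain ⟨k, hmem, hnot, h₁, h₂, hb, hc⟩ := exists_of_slide_eq_some h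
  have hcast : ((1 + k : ℕ) : ℤ) = k + 1 := by push_cast; ring
  rw [hcast] at hnot h₁ h₂ hb
  have hk : 1 ≤ k := by
    by_contra hk
    obtain rfl : k = 0 := by omega
    exact hnot (by simpa [mem_chapSet] using h1)
  refine ⟨d, hd, k, hk, fun i hi hi' => Finset.mem_union_left _ (hmem i hi (by omega)), ?_, h₁, h₂,
    hb, ?_⟩
  · rw [Finset.mem_union, not_or]
    exact ⟨hnot, hb ▸ hr⟩
  · rw [hc, add_comm 1 k, Finset.union_sdiff_distrib]
    congr 1
    refine (Finset.sdiff_eq_self_of_disjoint (hA.symm.mono_right ?_)).symm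
    intro q hq
    obtain ⟨i, hi, rfl⟩ := Finset.mem_image.1 hq
    rw [Finset.mem_Icc] at hi
    exact hmem i hi.1 (by omega)

theorem Hop.ssubset {n : ℤ} {b b' : ℤ × ℤ} {c c' : Finset (ℤ × ℤ)} (h : Hop n b c b' c') :
    c' ⊂ c := by
  obtain ⟨d, -, k, hk, hmem, -, -, -, -, rfl⟩ := h
  rw [Finset.ssubset_iff_of_subset Finset.sdiff_subset]
  refine ⟨_, hmem 1 le_rfl hk, fun h => (Finset.mem_sdiff.1 h).2 ?_⟩
  exact Finset.mem_image_of_mem (fun i : ℕ => ray b d i) (Finset.mem_Icc.2 ⟨le_rfl, hk⟩)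

theorem hop_ssubset {d : ℤ × ℤ} {c r : Conf} (hd : d ∈ dirs) (h : hop d c = some r) :
    chapSet r.2 ⊂ chapSet c.2 := by
  simpa using (hop_sound (A := ∅) hd h (by simp) (by simp)).ssubset

/-- Extra chaps create no new hop unless they touch the start or the landing point of one. -/
theorem exists_hop_of_union {b b' : ℤ × ℤ} {N : ℕ} {A c' : Finset (ℤ × ℤ)}
    (hA : Disjoint (chapSet N) A) (hstart : ∀ d ∈ dirs, b + d ∉ A)
    (hland : ∀ d ∈ dirs, ∀ r, hop d (b, N) = some r → r.1 ∉ A)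
    (h : Hop 10 b (chapSet N ∪ A) b' c') :
    ∃ d ∈ dirs, ∃ N', hop d (b, N) = some (b', N') ∧ c' = chapSet N' ∪ A := by
  obtain ⟨d, hd, k, hk, hmem, hnot, h₁, h₂, rfl, rfl⟩ := h
  have hcol : ∀ i : ℕ, 1 ≤ i → i ≤ k → 1 ≤ (ray b d i).1 ∧ (ray b d i).1 ≤ 10 := by
    have hs : ray b d 1 ∈ chapSet N := by
      have := Finset.mem_union.1 (hmem 1 le_rfl hk)
      rw [Nat.cast_one, ray_one] at this
      rw [ray_one]
      exact this.resolve_right (hstart d hd)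
    obtain ⟨h₃, h₄, -, -⟩ := onBoard_of_mem_chapSet hs
    intro i hi hi'
    simp only [ray] at h₁ h₂ h₃ h₄ ⊢
    simp only [dirs, Finset.mem_insert, Finset.mem_singleton] at hd
    rcases hd with rfl | rfl | rfl | rfl | rfl | rfl | rfl | rfl <;>
      simp at h₁ h₂ h₃ h₄ ⊢ <;> omega
  have hall : ∀ i : ℕ, 1 ≤ i → i ≤ k → ray b d i ∈ chapSet N := by
    intro i
    induction i using Nat.strong_induction_on with
    | _ i ih =>
      intro hi hi'
      by_contra hi''
      have hiA : ray b d i ∈ A := (Finset.mem_union.1 (hmem i hi hi')).resolve_left hi''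
      rcases hi.eq_or_lt with rfl | hlt
      · rw [Nat.cast_one, ray_one] at hiA
        exact hstart d hd hiA
      · obtain ⟨j, rfl⟩ : ∃ j, i = j + 1 := ⟨i - 1, by omega⟩
        have hcol' := hcol (j + 1) hi hi'
        push_cast at hiA hi'' hcol'
        obtain ⟨N', hN', -⟩ := hop_eq_some hd (show 1 ≤ j by omega)
          (fun l hl hl' => ih l (by omega) hl (by omega)) hi'' hcol'.1 hcol'.2
        exact hland d hd _ hN' hiA
  rw [Finset.mem_union, not_or] at hnot
  obtain ⟨N', hN', hc⟩ := hop_eq_some hd hk hall hnot.1 h₁ h₂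
  refine ⟨d, hd, N', hN', ?_⟩
  rw [hc, Finset.union_sdiff_distrib]
  congr 1
  refine Finset.sdiff_eq_self_of_disjoint (hA.symm.mono_right fun q hq => ?_)
  obtain ⟨i, hi, rfl⟩ := Finset.mem_image.1 hq
  rw [Finset.mem_Icc] at hi
  exact hall i hi.1 hi.2

/-! ### Jumps -/

theorem mem_jumps {k : ℕ} {c r : Conf} : r ∈ jumps (k + 1) c ↔
    ∃ d ∈ dirs, ∃ s, hop d c = some s ∧ (r = s ∨ inRows s.1 = true ∧ r ∈ jumps k s) := by
  simp only [jumps, List.mem_flatMap, mem_dirList]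
  refine exists_congr fun d => and_congr_right fun _ => ?_
  cases hop d c with
  | none => simp
  | some s => by_cases hs : inRows s.1 = true <;> simp [hs]

theorem mem_jumpZone {k : ℕ} {c : Conf} {q : ℤ × ℤ} : q ∈ jumpZone (k + 1) c ↔
    ∃ d ∈ dirs, q = c.1 + d ∨
      ∃ s, hop d c = some s ∧ (q = s.1 ∨ inRows s.1 = true ∧ q ∈ jumpZone k s) := by
  simp only [jumpZone, List.mem_flatMap, mem_dirList]
  refine exists_congr fun d => and_congr_right fun _ => ?_
  cases hop d c with
  | none => simp
  | some s => by_cases hs : inRows s.1 = true <;> simp [hs]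

theorem jump_of_mem_jumps {k : ℕ} {c r : Conf} (h : r ∈ jumps k c) :
    Jump 12 10 c.1 (chapSet c.2) r.1 (chapSet r.2) := by
  induction k generalizing c with
  | zero => simp [jumps] at h
  | succ k ih =>
    obtain ⟨d, hd, s, hs, h⟩ := mem_jumps.1 h
    have hhop : Hop 10 c.1 (chapSet c.2) s.1 (chapSet s.2) := by
      simpa using hop_sound (A := ∅) hd hs (by simp) (by simp)
    rcases h with rfl | ⟨hrows, h⟩
    · exact .single hhop
    · have := of_decide_eq_true hrows
      exact .cons hhop this.1 this.2 (ih h)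

/-- Extra chaps away from the jump zone create no new jump. -/
theorem exists_mem_jumps {A : Finset (ℤ × ℤ)} {b b' : ℤ × ℤ} {N k : ℕ} {c' : Finset (ℤ × ℤ)}
    (hk : (chapSet N).card < k) (hA : Disjoint (chapSet N) A)
    (hZ : ∀ q ∈ jumpZone k (b, N), q ∉ A) (h : Jump 12 10 b (chapSet N ∪ A) b' c') :
    ∃ N', (b', N') ∈ jumps k (b, N) ∧ chapSet N' ⊆ chapSet N ∧ c' = chapSet N' ∪ A := by
  generalize hc : chapSet N ∪ A = c at h
  have hstep : ∀ {b b₁ : ℤ × ℤ} {N k : ℕ} {c₁ : Finset (ℤ × ℤ)}, Disjoint (chapSet N) A →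
      (∀ q ∈ jumpZone (k + 1) (b, N), q ∉ A) → Hop 10 b (chapSet N ∪ A) b₁ c₁ →
      ∃ d ∈ dirs, ∃ N', hop d (b, N) = some (b₁, N') ∧ c₁ = chapSet N' ∪ A :=
    fun hA hZ h => exists_hop_of_union hA
      (fun d hd => hZ _ (mem_jumpZone.2 ⟨d, hd, .inl rfl⟩))
      (fun d hd r hr => hZ _ (mem_jumpZone.2 ⟨d, hd, .inr ⟨r, hr, .inl rfl⟩⟩)) h
  induction h generalizing N k with
  | single h =>
    subst hc
    obtain ⟨k, rfl⟩ : ∃ j, k = j + 1 := ⟨k - 1, by omega⟩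
    obtain ⟨d, hd, N', hN', rfl⟩ := hstep hA hZ h
    exact ⟨N', mem_jumps.2 ⟨d, hd, _, hN', .inl rfl⟩, (hop_ssubset hd hN').subset, rfl⟩
  | @cons b _ b₁ _ b' _ h hrow hrow' _ ih =>
    subst hc
    obtain ⟨k, rfl⟩ : ∃ j, k = j + 1 := ⟨k - 1, by omega⟩
    obtain ⟨d, hd, N₁, hN₁, rfl⟩ := hstep hA hZ h
    have hss : chapSet N₁ ⊂ chapSet N := hop_ssubset (c := (b, N)) (r := (b₁, N₁)) hd hN₁
    have hrows : inRows b₁ = true := by simp [inRows, hrow, hrow']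
    have hcard : (chapSet N₁).card < k := by
      have := Finset.card_lt_card hss
      omega
    have hZ₁ : ∀ q ∈ jumpZone k (b₁, N₁), q ∉ A := fun q hq =>
      hZ q (mem_jumpZone.2 ⟨d, hd, .inr ⟨_, hN₁, .inr ⟨hrows, hq⟩⟩⟩)
    obtain ⟨N', hN', hsub, rfl⟩ := ih hcard (hA.mono_left hss.subset) hZ₁ rfl
    exact ⟨N', mem_jumps.2 ⟨d, hd, _, hN₁, .inr ⟨hrows, hN'⟩⟩, hsub.trans hss.subset, rfl⟩

theorem card_chapSet_lt (N : ℕ) : (chapSet N).card < 121 := by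
  calc (chapSet N).card
      ≤ ((Finset.Icc (1 : ℤ) 10) ×ˢ (Finset.Icc (1 : ℤ) 12)).card := Finset.card_filter_le _ _
    _ = 120 := by simp only [Finset.card_product, Int.card_Icc]; rfl
    _ < 121 := by norm_num

/-- A winning jump survives adding chaps away from its landing points. -/
theorem exists_jump_of_winningJump {p : Player} {k : ℕ} {c : Conf} {L : List (ℤ × ℤ)}
    {A : Finset (ℤ × ℤ)} (h : winningJump p k c = some L) (hA : Disjoint (chapSet c.2) A)
    (hL : ∀ q ∈ L, q ∉ A) :
    ∃ b' c', Jump 12 10 c.1 (chapSet c.2 ∪ A) b' c' ∧ outcome b' = some p := by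
  induction k generalizing c L with
  | zero => simp [winningJump] at h
  | succ k ih =>
    obtain ⟨d, hd, h⟩ := List.exists_of_findSome?_eq_some h
    rw [mem_dirList] at hd
    cases hr : hop d c with
    | none => simp [hr] at h
    | some r =>
      simp only [hr] at h
      split_ifs at h with h₁ h₂
      · cases h
        exact ⟨_, _, .single (hop_sound hd hr hA (hL _ (by simp))), h₁⟩
      · obtain ⟨L', hL', rfl⟩ := Option.map_eq_some_iff.1 h
        obtain ⟨b', c', hj, hb₁⟩ := ih hL' (hA.mono_left (hop_ssubset hd hr).subset)
          fun q hq => hL q (List.mem_cons_of_mem _ hq)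
        have := of_decide_eq_true h₂
        exact ⟨b', c', .cons (hop_sound hd hr hA (hL _ (by simp))) this.1 this.2 hj, hb₁⟩

/-! ### Soundness of the search -/

/-- The game state with ball and chaps given by `c`, extra chaps `A`, and `p` to move. -/
noncomputable def Conf.toState (c : Conf) (A : Finset (ℤ × ℤ)) (p : Player) : PState :=
  ⟨c.1, chapSet c.2 ∪ A, p⟩

theorem winner_toState (c : Conf) (A : Finset (ℤ × ℤ)) (p : Player) :
    winner 12 (c.toState A p) = outcome c.1 := rfl

theorem vacant_iff {q : ℤ × ℤ} {c : Conf} :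
    vacant q c = true ↔ OnBoard 12 10 q ∧ q ∉ chapSet c.2 ∧ q ≠ c.1 := by
  simp [vacant, inBoard_iff, mem_chapSet, and_assoc]

theorem mem_placements {Z : List (ℤ × ℤ)} {c r : Conf} : r ∈ placements Z c ↔
    ∃ q ∈ Z, vacant q c = true ∧ (c.1, addChap c.2 q) = r := by
  simp [placements, and_assoc]

theorem moveRel_place {c : Conf} {A : Finset (ℤ × ℤ)} {p : Player} {q : ℤ × ℤ}
    (hq : vacant q c = true) (hqA : q ∉ A) :
    MoveRel 12 10 (c.toState A p) (Conf.toState (c.1, addChap c.2 q) A (!p)) := by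
  rw [vacant_iff] at hq
  refine ⟨rfl, .inl ⟨q, hq.1, ?_, hq.2.2, rfl, ?_⟩⟩
  · simp [Conf.toState, hq.2.1, hqA]
  · simp [Conf.toState, chapSet_addChap hq.1]

theorem moveRel_jump {c r : Conf} {k : ℕ} {p : Player} (h : r ∈ jumps k c) :
    MoveRel 12 10 (c.toState ∅ p) (r.toState ∅ (!p)) :=
  ⟨rfl, .inr (by simpa [Conf.toState] using jump_of_mem_jumps h)⟩

theorem MoveRel.flip {m n : ℤ} {s t : PState} (h : MoveRel m n s t) :
    MoveRel m n ⟨s.ball, s.chaps, !s.turn⟩ ⟨t.ball, t.chaps, !t.turn⟩ :=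
  ⟨by simp [h.1], h.2⟩

/-- The attack `att` of player `p` always forces a win within `k` moves, in the presence of any
further chaps away from the points it returns. -/
def SoundAttack (p : Player) (k : ℕ)
    (att : Conf → List (ℤ × ℤ) → Option (List (ℤ × ℤ) × List (ℤ × ℤ))) : Prop :=
  ∀ c cs x, att c cs = some x → ∀ A : Finset (ℤ × ℤ), Disjoint (chapSet c.2) A →
    (∀ q ∈ x.1, q ∉ A) → Forces 12 10 p k (c.toState A p)

variable {p : Player} {k : ℕ}
  {att : Conf → List (ℤ × ℤ) → Option (List (ℤ × ℤ) × List (ℤ × ℤ))}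

theorem forces_of_attackAll (hatt : SoundAttack p k att) {rs : List Conf} {A : Finset (ℤ × ℤ)}
    {Z cs : List (ℤ × ℤ)} {x : List (ℤ × ℤ) × List (ℤ × ℤ)} (h : attackAll att rs Z cs = some x)
    (hA : ∀ q ∈ x.1, q ∉ A) :
    (∀ q ∈ Z, q ∉ A) ∧
      ∀ r ∈ rs, Disjoint (chapSet r.2) A → Forces 12 10 p k (r.toState A p) := by
  induction rs generalizing Z cs with
  | nil =>
    cases h
    exact ⟨hA, by simp⟩
  | cons r rs ih =>
    rw [attackAll] at h
    cases hr : att r cs with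
    | none => simp [hr] at h
    | some y =>
      simp only [hr] at h
      obtain ⟨hZ, hrs⟩ := ih h
      refine ⟨fun q hq => hZ q (List.mem_append_right _ hq), fun r' hr' hd => ?_⟩
      rcases List.mem_cons.1 hr' with rfl | hr'
      · exact hatt _ _ _ hr A hd fun q hq => hZ q (List.mem_append_left _ hq)
      · exact hrs r' hr' hd

theorem forces_of_refute (hatt : SoundAttack p k att) {skip : List Conf} {c : Conf}
    {cs : List (ℤ × ℤ)} {x : List (ℤ × ℤ) × List (ℤ × ℤ)} (h : refute att skip c cs = some x)
    {A : Finset (ℤ × ℤ)} (hA : Disjoint (chapSet c.2) A) (hx : ∀ q ∈ x.1, q ∉ A) :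
    Forces 12 10 p k (c.toState A p) ∧ ∀ t, MoveRel 12 10 (c.toState A (!p)) t →
      (∃ r ∈ skip, t = r.toState A p) ∨ Forces 12 10 p k t := by
  rw [refute] at h
  cases hnull : att c cs with
  | none => simp [hnull] at h
  | some y =>
    simp only [hnull] at h
    obtain ⟨hZ, hrs⟩ := forces_of_attackAll hatt h hx
    have hy : ∀ q ∈ y.1, q ∉ A := fun q hq => hZ q (List.mem_append_left _ hq)
    have hreply : ∀ r ∈ placements y.1 c ++ jumps 121 c, Disjoint (chapSet r.2) A →
        (∃ r' ∈ skip, r.toState A p = r'.toState A p) ∨ Forces 12 10 p k (r.toState A p) := by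
      intro r hr hd
      by_cases hs : r ∈ skip
      · exact .inl ⟨r, hs, rfl⟩
      · exact .inr (hrs r (List.mem_filter.2 ⟨hr, by simpa using hs⟩) hd)
    refine ⟨hatt _ _ _ hnull A hA hy, ?_⟩
    rintro ⟨b', c', turn⟩ ⟨hturn, ⟨q, hq, hqc, hqb, hb, hc⟩ | hj⟩
    · simp only [Conf.toState, Bool.not_not, Finset.mem_union, not_or] at hturn hqc hqb hb hc
      subst hturn hb hc
      by_cases hqZ : q ∈ y.1
      · have heq : insert q (chapSet c.2 ∪ A) = chapSet (addChap c.2 q) ∪ A := by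
          rw [chapSet_addChap hq, Finset.insert_union]
        rw [heq]
        refine hreply (c.1, addChap c.2 q) (List.mem_append_left _ (mem_placements.2
          ⟨q, hqZ, vacant_iff.2 ⟨hq, hqc.1, hqb⟩, rfl⟩)) ?_
        rw [chapSet_addChap hq, Finset.disjoint_insert_left]
        exact ⟨hqc.2, hA⟩
      · rw [← Finset.union_insert]
        refine .inr (hatt _ _ _ hnull (insert q A) ?_ fun q' hq' => ?_)
        · rw [Finset.disjoint_insert_right]
          exact ⟨hqc.1, hA⟩
        · rw [Finset.mem_insert, not_or]
          exact ⟨fun h => hqZ (h ▸ hq'), hy q' hq'⟩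
    · simp only [Conf.toState, Bool.not_not] at hturn hj
      subst hturn
      obtain ⟨N', hN', hsub, rfl⟩ := exists_mem_jumps (card_chapSet_lt _) hA
        (fun q hq => hZ q (List.mem_append_right _ hq)) hj
      exact hreply (b', N') (List.mem_append_right _ hN') (hA.mono_left hsub)

theorem soundAttack_attack (p : Player) (k : ℕ) : SoundAttack p (2 * k) (attack p k) := by
  induction k with
  | zero => intro c cs x h; simp [attack] at h
  | succ k ih =>
    intro c cs x h A hA hx
    unfold attack at h
    split_ifs at h with h₁ h₂
    · exact .won h₁
    · cases hw : winningJump p 8 c with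
      | some L =>
        simp only [hw, Option.some.injEq] at h
        subst h
        obtain ⟨b', c', hj, hb'⟩ := exists_jump_of_winningJump hw hA hx
        exact .mine (t := ⟨b', c', !p⟩) h₂ rfl ⟨rfl, .inr hj⟩ (.won hb')
      | none =>
        cases cs with
        | nil => simp [hw] at h
        | cons q cs =>
          simp only [hw] at h
          split_ifs at h with hq
          obtain ⟨y, hy, rfl⟩ := Option.map_eq_some_iff.1 h
          simp only [List.mem_dedup, List.mem_cons, forall_eq_or_imp] at hx
          have hd : Disjoint (chapSet (addChap c.2 q)) A := by
            rw [chapSet_addChap (vacant_iff.1 hq).1, Finset.disjoint_insert_left]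
            exact ⟨hx.1, hA⟩
          obtain ⟨hnull, hall⟩ := forces_of_refute ih hy hd hx.2
          obtain ⟨t, ht⟩ := hnull.exists_move h₂
          refine .mine (k := 2 * k + 1) h₂ rfl (moveRel_place hq hx.1)
            (.theirs h₂ (by simp [Conf.toState]) ⟨_, ht.flip⟩ fun t ht => ?_)
          simpa using hall t ht

theorem LineMove.moveRel {a : LineMove} {c r : Conf} {p : Player} (h : a.apply c = some r) :
    MoveRel 12 10 (c.toState ∅ p) (r.toState ∅ (!p)) := by
  cases a with
  | place q =>
    simp only [LineMove.apply] at h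
    split_ifs at h with hq
    cases h
    exact moveRel_place hq (by simp)
  | jump q => exact moveRel_jump (List.mem_of_find?_eq_some h)

/-- Alfred does not win from the start of a checked line that returns to its start. -/
theorem not_winsFrom_of_lineCheck {goal : Conf}
    {x : LineMove × LineMove × List (ℤ × ℤ)} {l : List (LineMove × LineMove × List (ℤ × ℤ))}
    (h : lineCheck goal (x :: l) goal = true) :
    ¬ WinsFrom 12 10 true (goal.toState ∅ true) := by
  set OnLine : Conf → Prop := fun c => ∃ x l, lineCheck goal (x :: l) c = true
  have hstep : ∀ c, OnLine c → outcome c.1 = none ∧ ∃ r : Conf, outcome r.1 = none ∧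
      (∀ t, MoveRel 12 10 (c.toState ∅ true) t →
        t = r.toState ∅ false ∨ ∃ k, Forces 12 10 false k t) ∧
      ∃ c' : Conf, MoveRel 12 10 (r.toState ∅ false) (c'.toState ∅ true) ∧ OnLine c' := by
    rintro c ⟨⟨a, b, cs⟩, l, hl⟩
    rw [lineCheck] at hl
    cases ha : a.apply c with
    | none => simp [ha] at hl
    | some r =>
      cases hb : b.apply r with
      | none => simp [ha, hb] at hl
      | some c' =>
        simp only [ha, hb, Bool.and_eq_true, decide_eq_true_eq, Option.isSome_iff_exists] at hl
        obtain ⟨⟨⟨h₁, h₂⟩, y, hy⟩, h₃⟩ := hl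
        refine ⟨h₁, r, h₂, fun t ht => ?_, c', LineMove.moveRel hb, ?_⟩
        · rcases (forces_of_refute (soundAttack_attack false 20) hy (A := ∅) (by simp)
            (by simp)).2 t ht with ⟨r', hr', ht⟩ | ht
          · rw [List.mem_singleton.1 hr'] at ht
            exact .inl ht
          · exact .inr ⟨_, ht⟩
        · cases l with
          | nil =>
            obtain rfl : c' = goal := of_decide_eq_true h₃
            exact ⟨_, _, h⟩
          | cons y l => exact ⟨y, l, h₃⟩
  refine not_winsFrom_of_region (fun s => (∃ k, Forces 12 10 false k s) ∨
    (∃ c, OnLine c ∧ s = c.toState ∅ true) ∨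
    ∃ r : Conf, outcome r.1 = none ∧ s = r.toState ∅ false ∧
      ∃ c' : Conf, MoveRel 12 10 s (c'.toState ∅ true) ∧ OnLine c') ?_ ?_ ?_
    (.inr (.inl ⟨_, ⟨x, l, h⟩, rfl⟩))
  · rintro s (⟨k, hk⟩ | ⟨c, hc, rfl⟩ | ⟨r, hr, rfl, -⟩)
    · cases hk <;> simp_all
    · simp [winner_toState, (hstep c hc).1]
    · simp [winner_toState, hr]
  · rintro s (⟨k, hk⟩ | ⟨c, hc, rfl⟩ | ⟨r, hr, rfl, -⟩) hw hturn t ht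
    · cases hk with
      | won h => simp [hw] at h
      | mine _ h _ _ => simp [hturn] at h
      | theirs _ _ _ h => exact .inl ⟨_, h t ht⟩
    · obtain ⟨-, r, hr, hall, c', hc', hline⟩ := hstep c hc
      rcases hall t ht with rfl | h
      · exact .inr (.inr ⟨r, hr, rfl, c', hc', hline⟩)
      · exact .inl h
    · simp [Conf.toState] at hturn
  · rintro s (⟨k, hk⟩ | ⟨c, hc, rfl⟩ | ⟨r, hr, rfl, c', hc', hline⟩) hw hturn
    · cases hk with
      | won h => simp [hw] at h
      | mine _ _ h₁ h₂ => exact ⟨_, h₁, .inl ⟨_, h₂⟩⟩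
      | theirs _ h _ _ => simp [hturn] at h
    · simp [Conf.toState] at hturn
    · exact ⟨_, hc', .inr (.inl ⟨c', hline, rfl⟩)⟩

/-! ### The positions `P1` and `P1_c4` -/

theorem confP1_toState : confP1.toState ∅ false = P1 := by
  have h : chapSet confP1.2 = P1.chaps := by decide +kernel
  rw [Conf.toState, h, Finset.union_empty]
  rfl

theorem confP1c4_toState : confP1c4.toState ∅ true = P1_c4 := by
  have h : chapSet confP1c4.2 = P1_c4.chaps := by decide +kernel
  rw [Conf.toState, h, Finset.union_empty]
  rfl

/-- From `P1`, placing a chap at c4 is Betty's unique non-losing move: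
it is a legal move; after it, Alfred has no winning strategy from the resulting
position; and every other legal move of Betty from `P1` leads to a position
from which Alfred has a winning strategy. -/
theorem P1_unique_nonlosing :
    MoveRel 12 10 P1 P1_c4 ∧
    ¬ WinsFrom 12 10 true P1_c4 ∧
    ∀ t, MoveRel 12 10 P1 t → t ≠ P1_c4 → WinsFrom 12 10 true t := by
  have hline : lineCheck confP1c4 mainLine confP1c4 = true := by decide +kernel
  have hdev : (refute (attack true 5) [confP1c4] confP1 [(4, 6)]).isSome = true := by
    decide +kernel
  obtain ⟨x, hx⟩ := Option.isSome_iff_exists.1 hdev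
  rw [← confP1_toState, ← confP1c4_toState]
  refine ⟨moveRel_place (q := (3, 4)) (by decide +kernel) (by simp),
    not_winsFrom_of_lineCheck hline, fun t ht hne => ?_⟩
  rcases (forces_of_refute (soundAttack_attack true 5) hx (A := ∅) (by simp) (by simp)).2 t ht with
    ⟨r, hr, rfl⟩ | h
  · rw [List.mem_singleton.1 hr] at hne
    exact absurd rfl hne
  · exact h.winsFrom
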